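/- Let p ≥ 5 be a prime, let k be a positive integer, and let F ∈ ℤ_(p)[Q,R] be isobaric of weight k and not involving P. Then D^{p²}F is a modular form mod p²; precisely, there exists a polynomial G ∈ ℤ_(p)[Q,R], isobaric of weight k+2p² and not involving P, such that D^{p²}F − G ∈ p²·ℤ_(p)[P,Q,R]. -/

import Mathlib

open MvPolynomial Finset

noncomputable section

/-- `x` lies in `ℤ_(p) ⊆ ℚ`: `p` does not divide the reduced denominator of `x`. -/
def pInt (p : ℕ) (x : ℚ) : Prop := ¬ p ∣ x.den

/-- The polynomial ring `ℚ[P,Q,R]`, with `P = X 0`, `Q = X 1`, `R = X 2`. -/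
abbrev Poly3 : Type := MvPolynomial (Fin 3) ℚ

/-- `f` has all of its coefficients in `ℤ_(p)`. -/
def polyPInt (p : ℕ) (f : Poly3) : Prop := ∀ m : Fin 3 →₀ ℕ, pInt p (coeff m f)

/-- `f` is isobaric of weight `w`, where `P, Q, R` have weights `2, 4, 6`. -/
def Isobaric (w : ℕ) (f : Poly3) : Prop :=
  ∀ m ∈ f.support, 2 * m 0 + 4 * m 1 + 6 * m 2 = w

/-- `f` does not involve the variable `P`. -/
def NoP (f : Poly3) : Prop := ∀ m ∈ f.support, m 0 = 0

/-- The Ramanujan derivation `D` on `ℚ[P,Q,R]`, the unique derivation with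
`DP = (P²-Q)/12`, `DQ = (PQ-R)/3`, `DR = (PR-Q²)/2`. -/
def Dop (f : Poly3) : Poly3 :=
  C (1/12 : ℚ) * (X 0 ^ 2 - X 1) * pderiv 0 f
    + C (1/3 : ℚ) * (X 0 * X 1 - X 2) * pderiv 1 f
    + C (1/2 : ℚ) * (X 0 * X 2 - X 1 ^ 2) * pderiv 2 f

/-- The sum of the `j`-th powers of the divisors of `n`, as a rational number. -/
def sigmaQ (j n : ℕ) : ℚ := ∑ d ∈ n.divisors, (d : ℚ) ^ j

/-- The q-expansion of `E₂`. -/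
def E2s : PowerSeries ℚ := PowerSeries.mk fun n => if n = 0 then 1 else -24 * sigmaQ 1 n

/-- The q-expansion of `E₄`. -/
def E4s : PowerSeries ℚ := PowerSeries.mk fun n => if n = 0 then 1 else 240 * sigmaQ 3 n

/-- The q-expansion of `E₆`. -/
def E6s : PowerSeries ℚ := PowerSeries.mk fun n => if n = 0 then 1 else -504 * sigmaQ 5 n

/-- The q-expansion of the normalized Eisenstein series `E_{p-1}`. -/
def EAs (p : ℕ) : PowerSeries ℚ :=
  PowerSeries.mk fun n => if n = 0 then 1 else
    -(2 * ((p : ℚ) - 1) / bernoulli (p - 1)) * sigmaQ (p - 2) n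

/-- The q-expansion of the normalized Eisenstein series `E_{p+1}`. -/
def EBs (p : ℕ) : PowerSeries ℚ :=
  PowerSeries.mk fun n => if n = 0 then 1 else
    -(2 * ((p : ℚ) + 1) / bernoulli (p + 1)) * sigmaQ p n

/-- `Φ : ℚ[P,Q,R] → ℚ[[q]]`, the algebra map sending `P, Q, R` to `E₂, E₄, E₆`. -/
def Phi : Poly3 →ₐ[ℚ] PowerSeries ℚ := aeval ![E2s, E4s, E6s]

/-- The theta operator attached to the polynomials `A` and `B`:
`θf = ((BQ-AR)/3)·∂f/∂Q + ((BR-AQ²)/2)·∂f/∂R`. -/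
def thetaOp (A B f : Poly3) : Poly3 :=
  C (1/3 : ℚ) * (B * X 1 - A * X 2) * pderiv 1 f
    + C (1/2 : ℚ) * (B * X 2 - A * X 1 ^ 2) * pderiv 2 f

/-- `f` lies in the `n`-th power of the ideal `(A^p, p)` of `ℤ_(p)[P,Q,R]`. -/
def InIdealPow (p : ℕ) (A : Poly3) (n : ℕ) (f : Poly3) : Prop :=
  ∃ G : ℕ → Poly3, (∀ i, polyPInt p (G i)) ∧
    f = ∑ i ∈ Finset.range (n + 1), (p : Poly3) ^ (n - i) * A ^ (p * i) * G i

/-- The coefficient of `u^(n-j) f_j` in the `n`-th derivative. -/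
def cc (k n j : ℕ) : ℕ := n.choose j * (k + j).ascFactorial (n - j)

theorem cc_zero_succ (k n : ℕ) : cc k (n + 1) 0 = cc k n 0 * (k + n) := by
  simp [cc, Nat.ascFactorial_succ, mul_comm]

theorem cc_gt (k n j : ℕ) (h : n < j) : cc k n j = 0 := by
  simp [cc, Nat.choose_eq_zero_of_lt h]

theorem asc_left (a m : ℕ) : a.ascFactorial (m + 1) = a * (a + 1).ascFactorial m := by
  rw [Nat.ascFactorial_succ]; exact (Nat.succ_ascFactorial a m).symm

theorem cc_step (k n j : ℕ) : cc k n j * (n - j) = cc k n (j + 1) * ((j + 1) * (k + j)) := by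
  rcases Nat.lt_or_ge j n with h | h
  · obtain ⟨m, rfl⟩ : ∃ m, n = j + m + 1 := ⟨n - j - 1, by omega⟩
    have h1 := Nat.choose_succ_right_eq (j + m + 1) j
    have e1 : j + m + 1 - j = m + 1 := by omega
    have e2 : j + m + 1 - (j + 1) = m := by omega
    rw [e1] at h1
    simp only [cc, e1, e2, asc_left, ← add_assoc]
    calc _ = ((j + m + 1).choose j * (m + 1)) * ((k + j) * (k + j + 1).ascFactorial m) := by ring
      _ = _ := by rw [← h1]; ring
  · rw [cc_gt k n (j + 1) (by omega), Nat.sub_eq_zero_of_le h]; simp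

theorem cc_succ (k n j : ℕ) (h : j ≤ n) :
    cc k (n + 1) (j + 1) = cc k n (j + 1) * (n + k + (j + 1)) + cc k n j := by
  rcases Nat.lt_or_ge j n with h | h
  · obtain ⟨m, rfl⟩ : ∃ m, n = j + m + 1 := ⟨n - j - 1, by omega⟩
    have h1 := Nat.choose_succ_right_eq (j + m + 1) j
    have e1 : j + m + 1 - j = m + 1 := by omega
    have e2 : j + m + 1 - (j + 1) = m := by omega
    have e3 : j + m + 1 + 1 - (j + 1) = m + 1 := by omega
    rw [e1] at h1
    simp only [cc, e1, e2, e3, Nat.choose_succ_succ (j + m + 1) j]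
    rw [asc_left (k + j), Nat.ascFactorial_succ, ← add_assoc]
    zify at h1 ⊢
    linear_combination (-((k + j + 1).ascFactorial m : ℤ)) * h1
  · obtain rfl : j = n := by omega
    rw [cc_gt k j (j + 1) (by omega)]
    simp [cc]

theorem cc_dvd (k n j : ℕ) (h : j < n) : n ∣ cc k n j := by
  have h1 : (n - j).factorial ∣ (k + j).ascFactorial (n - j) := Nat.factorial_dvd_ascFactorial _ _
  have h2 : n ∣ n.choose j * (n - j).factorial := by
    rw [← Nat.choose_symm h.le, mul_comm, ← Nat.descFactorial_eq_factorial_mul_choose]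
    obtain ⟨m, hm⟩ : ∃ m, n - j = m + 1 := ⟨n - j - 1, by omega⟩
    obtain ⟨n', rfl⟩ : ∃ n', n = n' + 1 := ⟨n - 1, by omega⟩
    rw [hm, Nat.succ_descFactorial_succ]
    exact dvd_mul_right _ _
  exact h2.trans (mul_dvd_mul_left _ h1)

theorem iter_formula {K A : Type*} [CommRing K] [CommRing A] [Algebra K A] (D : Derivation K A A) (k : ℕ) (u q : A) (f : ℕ → A)
    (hu : D u = u ^ 2 - q) (h0 : D (f 0) = k * u * f 0 + f 1)
    (hs : ∀ j, D (f (j + 1)) = (k + 2 * (j + 1) : ℕ) * u * f (j + 1) + f (j + 2)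
      + (((j + 1) * (k + j) : ℕ) : A) * q * f j) (n : ℕ) :
    D^[n] (f 0) = ∑ j ∈ Finset.range (n + 1), (cc k n j : A) * u ^ (n - j) * f j := by
  induction n with
  | zero => simp [cc]
  | succ n ih =>
    rw [Function.iterate_succ_apply', ih, map_sum]
    let X1 : ℕ → A := fun j => (cc k n j : A) * (n + k + j : ℕ) * u ^ (n + 1 - j) * f j
    let X2 : ℕ → A := fun j => (cc k n j : A) * u ^ (n - j) * f (j + 1)
    let X3 : ℕ → A := fun j => (cc k n j * (n - j) : ℕ) * u ^ (n - j - 1) * q * f j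
    let X4 : ℕ → A := fun j => (cc k n j * (j * (k + j - 1)) : ℕ) * u ^ (n - j) * q * f (j - 1)
    have key : ∀ j ∈ Finset.range (n + 1), D ((cc k n j : A) * u ^ (n - j) * f j)
        = X1 j + X2 j + (X4 j - X3 j) := by
      intro j hj
      have hj' : j ≤ n := by simpa [Nat.lt_succ_iff] using hj
      obtain ⟨m, rfl⟩ := Nat.exists_eq_add_of_le hj'
      have e1 : j + m - j = m := by omega
      have e2 : j + m + 1 - j = m + 1 := by omega
      have hf : D (f j) = (k + 2 * j : ℕ) * u * f j + f (j + 1)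
          + ((j * (k + j - 1) : ℕ) : A) * q * f (j - 1) := by
        cases j with
        | zero => simp [h0]
        | succ j => rw [hs]; simp [← add_assoc]
      have hpow : D (u ^ m) = (m : A) * u ^ (m + 1) - (m : A) * u ^ (m - 1) * q := by
        rw [Derivation.leibniz_pow, hu]
        cases m with
        | zero => simp
        | succ m => simp; ring
      simp only [X1, X2, X3, X4, e1, e2, Derivation.leibniz, hf, hpow, smul_eq_mul,
        Derivation.map_natCast]
      generalize j * (k + j - 1) = z
      push_cast
      ring
    rw [Finset.sum_congr rfl key, Finset.sum_add_distrib, Finset.sum_add_distrib,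
      Finset.sum_sub_distrib]
    have h34 : ∑ j ∈ Finset.range (n + 1), X4 j = ∑ j ∈ Finset.range (n + 1), X3 j := by
      rw [Finset.sum_range_succ', Finset.sum_range_succ]
      have : X4 0 = 0 := by simp [X4]
      rw [this]
      have : X3 n = 0 := by simp [X3]
      rw [this]
      congr 1
      refine Finset.sum_congr rfl fun j hj => ?_
      simp only [X3, X4, cc_step, Nat.add_sub_cancel, ← add_assoc, Nat.sub_sub]
    have hX1 : ∑ j ∈ Finset.range (n + 1), X1 j = ∑ j ∈ Finset.range (n + 2), X1 j := by
      rw [Finset.sum_range_succ X1 (n + 1)]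
      simp [X1, cc_gt k n (n + 1) (by omega)]
    rw [h34, sub_self, add_zero, hX1, Finset.sum_range_succ' _ (n + 1),
      Finset.sum_range_succ' _ (n + 1), add_right_comm, ← Finset.sum_add_distrib]
    congr 1
    · refine Finset.sum_congr rfl fun j hj => ?_
      have hj' : j ≤ n := by simpa [Nat.lt_succ_iff] using hj
      have e : n + 1 - (j + 1) = n - j := by omega
      simp only [X1, X2, e, cc_succ k n j hj']
      push_cast; ring
    · simp only [X1, cc_zero_succ]
      push_cast; ring

/-! ### p-integrality -/

theorem pInt_add {p : ℕ} (hp : p.Prime) {x y : ℚ} (hx : pInt p x) (hy : pInt p y) :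
    pInt p (x + y) := fun h =>
  ((hp.dvd_mul).1 (h.trans (Rat.add_den_dvd x y))).elim hx hy

theorem pInt_mul {p : ℕ} (hp : p.Prime) {x y : ℚ} (hx : pInt p x) (hy : pInt p y) :
    pInt p (x * y) := fun h =>
  ((hp.dvd_mul).1 (h.trans (Rat.mul_den_dvd x y))).elim hx hy

theorem pInt_nat {p : ℕ} (hp : p.Prime) (n : ℕ) : pInt p (n : ℚ) := by
  simp [pInt, hp.one_lt.ne']

theorem pInt_neg {p : ℕ} {x : ℚ} (hx : pInt p x) : pInt p (-x) := by
  simpa [pInt] using hx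

/-- Polynomials with coefficients in `ℤ_(p)` as a subring. -/
def intRing (p : ℕ) (hp : p.Prime) : Subring Poly3 where
  carrier := {f | polyPInt p f}
  zero_mem' := fun m => by simpa using pInt_nat hp 0
  one_mem' := fun m => by
    rw [coeff_one]; split_ifs
    · simpa using pInt_nat hp 1
    · simpa using pInt_nat hp 0
  add_mem' := fun {a b} ha hb m => by rw [coeff_add]; exact pInt_add hp (ha m) (hb m)
  neg_mem' := fun {a} ha m => by rw [coeff_neg]; exact pInt_neg (ha m)
  mul_mem' := fun {a b} ha hb m => by
    rw [coeff_mul]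
    refine Finset.sum_induction _ (pInt p) (fun _ _ => pInt_add hp) (by simpa using pInt_nat hp 0) ?_
    intro x _
    exact pInt_mul hp (ha _) (hb _)

theorem C_mem {p : ℕ} (hp : p.Prime) {x : ℚ} (hx : pInt p x) : (C x : Poly3) ∈ intRing p hp := by
  intro m
  rw [coeff_C]; split_ifs
  · exact hx
  · simpa using pInt_nat hp 0

theorem X_mem {p : ℕ} (hp : p.Prime) (i : Fin 3) : (X i : Poly3) ∈ intRing p hp := by
  intro m
  rw [coeff_X]; split_ifs
  · simpa using pInt_nat hp 1
  · simpa using pInt_nat hp 0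

theorem pderiv_mem {p : ℕ} (hp : p.Prime) (i : Fin 3) {f : Poly3} (hf : f ∈ intRing p hp) :
    pderiv i f ∈ intRing p hp := by
  intro m
  rw [coeff_pderiv]
  exact pInt_mul hp (hf _) (by exact_mod_cast pInt_nat hp (m i + 1))

theorem pInt_inv {p : ℕ} (hp : p.Prime) (hp5 : 5 ≤ p) (a b : ℕ) :
    pInt p (1 / (2 ^ a * 3 ^ b : ℕ)) := by
  intro h
  have h1 : p ∣ 2 ^ a * 3 ^ b := by
    refine h.trans ?_
    have := Rat.den_dvd 1 ((2 ^ a * 3 ^ b : ℕ) : ℤ)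
    rw [Rat.divInt_eq_div, Int.cast_one, Int.cast_natCast] at this
    exact Int.natCast_dvd_natCast.1 this
  rcases (hp.dvd_mul).1 h1 with h | h
  · have := Nat.le_of_dvd (by norm_num) (hp.dvd_of_dvd_pow h); omega
  · have := Nat.le_of_dvd (by norm_num) (hp.dvd_of_dvd_pow h); omega

/-! ### weights -/

/-- Weights, over the integers. -/
def wt : Fin 3 → ℤ := ![2, 4, 6]

/-- Degree in `P`. -/
def wP : Fin 3 → ℤ := ![1, 0, 0]

theorem weight_three {M : Type*} [AddCommMonoid M] (w : Fin 3 → M) (m : Fin 3 →₀ ℕ) :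
    (m.sum fun i c => c • w i) = m 0 • w 0 + m 1 • w 1 + m 2 • w 2 := by
  rw [Finsupp.sum_fintype _ _ (fun i => by simp), Fin.sum_univ_three]

theorem wh_cast {w : Fin 3 → ℤ} {f : Poly3} {a b : ℤ} (h : IsWeightedHomogeneous w f a)
    (e : a = b) : IsWeightedHomogeneous w f b := e ▸ h

theorem iso_iff (w : ℕ) (f : Poly3) : Isobaric w f ↔ IsWeightedHomogeneous wt f (w : ℤ) := by
  simp only [Isobaric, IsWeightedHomogeneous, mem_support_iff, Finsupp.weight_apply,
    weight_three, wt]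
  refine forall_congr' fun m => imp_congr_right fun _ => ?_
  simp
  omega

theorem noP_iff (f : Poly3) : NoP f ↔ IsWeightedHomogeneous wP f 0 := by
  simp only [NoP, IsWeightedHomogeneous, mem_support_iff, Finsupp.weight_apply,
    weight_three, wP]
  refine forall_congr' fun m => imp_congr_right fun _ => ?_
  simp

theorem noP_pderiv {f : Poly3} (h : NoP f) : pderiv 0 f = 0 := by
  ext m
  rw [coeff_pderiv]
  by_cases h0 : coeff (m + Finsupp.single 0 1) f = 0
  · simp [h0]
  · have := h _ (mem_support_iff.2 h0)
    simp at this

theorem euler {w : ℕ} {f : Poly3} (h : Isobaric w f) (h' : NoP f) :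
    4 * X 1 * pderiv 1 f + 6 * X 2 * pderiv 2 f = (w : Poly3) * f := by
  have h2 : IsWeightedHomogeneous (![2, 4, 6] : Fin 3 → ℕ) f w := by
    intro m hm
    have := h m (mem_support_iff.2 hm)
    rw [Finsupp.weight_apply, weight_three]
    simp
    omega
  have := h2.sum_weight_X_mul_pderiv
  rw [Fin.sum_univ_three, noP_pderiv h'] at this
  simp at this
  rw [← this]; ring

/-- The Serre derivative on `ℚ[Q,R]`. -/
def th (f : Poly3) : Poly3 := -(C (1/3 : ℚ) * X 2 * pderiv 1 f + C (1/2 : ℚ) * X 1 ^ 2 * pderiv 2 f)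

/-- `f ∈ ℤ_(p)[Q,R]` isobaric of weight `w`. -/
def Good (p w : ℕ) (f : Poly3) : Prop := Isobaric w f ∧ NoP f ∧ polyPInt p f

theorem good_sub {p : ℕ} (hp : p.Prime) {w : ℕ} {f g : Poly3} (hf : Good p w f) (hg : Good p w g) :
    Good p w (f - g) := by
  refine ⟨?_, ?_, (intRing p hp).sub_mem hf.2.2 hg.2.2⟩
  · rw [iso_iff]; exact ((iso_iff _ _).1 hf.1).sub ((iso_iff _ _).1 hg.1)
  · rw [noP_iff]; exact ((noP_iff _).1 hf.2.1).sub ((noP_iff _).1 hg.2.1)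

theorem good_Q {p : ℕ} (hp : p.Prime) {w : ℕ} {f : Poly3} (c : ℚ) (hc : pInt p c)
    (hf : Good p w f) : Good p (w + 4) (C c * X 1 * f) := by
  refine ⟨?_, ?_, (intRing p hp).mul_mem ((intRing p hp).mul_mem (C_mem hp hc) (X_mem hp 1)) hf.2.2⟩
  · rw [iso_iff]
    refine wh_cast (((isWeightedHomogeneous_X ℚ wt 1).C_mul c).mul ((iso_iff _ _).1 hf.1)) ?_
    simp [wt, wP]
    try ring
  · rw [noP_iff]
    refine wh_cast (((isWeightedHomogeneous_X ℚ wP 1).C_mul c).mul ((noP_iff _).1 hf.2.1)) ?_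
    simp [wt, wP]
    try ring

theorem good_th {p : ℕ} (hp : p.Prime) (hp5 : 5 ≤ p) {w : ℕ} {f : Poly3}
    (hf : Good p w f) : Good p (w + 2) (th f) := by
  have h3 : pInt p (1/3) := by simpa using pInt_inv hp hp5 0 1
  have h2 : pInt p (1/2) := by simpa using pInt_inv hp hp5 1 0
  refine ⟨?_, ?_, ?_⟩
  · rw [iso_iff]
    have hh := (iso_iff _ _).1 hf.1
    refine IsWeightedHomogeneous.neg (IsWeightedHomogeneous.add ?_ ?_)
    · refine wh_cast (((isWeightedHomogeneous_X ℚ wt 2).C_mul (1/3)).mul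
        (hh.pderiv (i := 1) (n' := (w : ℤ) - 4) (by simp [wt]))) ?_
      simp [wt, wP]
      try ring
    · refine wh_cast ((((isWeightedHomogeneous_X ℚ wt 1).pow 2).C_mul (1/2)).mul
        (hh.pderiv (i := 2) (n' := (w : ℤ) - 6) (by simp [wt]))) ?_
      simp [wt, wP]
      try ring
  · rw [noP_iff]
    have hh := (noP_iff _).1 hf.2.1
    refine IsWeightedHomogeneous.neg (IsWeightedHomogeneous.add ?_ ?_)
    · refine wh_cast (((isWeightedHomogeneous_X ℚ wP 2).C_mul (1/3)).mul
        (hh.pderiv (i := 1) (n' := 0) (by simp [wP]))) ?_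
      simp [wt, wP]
      try ring
    · refine wh_cast ((((isWeightedHomogeneous_X ℚ wP 1).pow 2).C_mul (1/2)).mul
        (hh.pderiv (i := 2) (n' := 0) (by simp [wP]))) ?_
      simp [wt, wP]
      try ring
  · refine (intRing p hp).neg_mem ((intRing p hp).add_mem ?_ ?_)
    · exact (intRing p hp).mul_mem ((intRing p hp).mul_mem (C_mem hp h3) (X_mem hp 2))
        (pderiv_mem hp 1 hf.2.2)
    · exact (intRing p hp).mul_mem ((intRing p hp).mul_mem (C_mem hp h2)
        ((intRing p hp).pow_mem (X_mem hp 1) 2)) (pderiv_mem hp 2 hf.2.2)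

/-- The sequence `f_j` attached to `F`. -/
def ff (k : ℕ) (F : Poly3) : ℕ → Poly3
  | 0 => F
  | 1 => th F
  | (j + 2) => th (ff k F (j + 1)) - C (((j + 1) * (k + j) : ℕ) * (1/144 : ℚ)) * X 1 * ff k F j

theorem good_ff {p : ℕ} (hp : p.Prime) (hp5 : 5 ≤ p) {k : ℕ} {F : Poly3}
    (hF : Good p k F) (j : ℕ) : Good p (k + 2 * j) (ff k F j) ∧
      Good p (k + 2 * (j + 1)) (ff k F (j + 1)) := by
  induction j with
  | zero => exact ⟨hF, good_th hp hp5 hF⟩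
  | succ j ih =>
    refine ⟨ih.2, ?_⟩
    have h144 : pInt p (1/144) := by
      have := pInt_inv hp hp5 4 2
      norm_num at this ⊢
      exact this
    exact good_sub hp (good_th hp hp5 ih.2)
      (good_Q hp _ (pInt_mul hp (pInt_nat hp _) h144) ih.1)

/-- `Dop` as a derivation. -/
def DD : Derivation ℚ Poly3 Poly3 :=
  (C (1/12 : ℚ) * (X 0 ^ 2 - X 1) : Poly3) • pderiv 0
    + (C (1/3 : ℚ) * (X 0 * X 1 - X 2) : Poly3) • pderiv 1
    + (C (1/2 : ℚ) * (X 0 * X 2 - X 1 ^ 2) : Poly3) • pderiv 2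

theorem DD_eq : (DD : Poly3 → Poly3) = Dop := by
  funext f
  simp [DD, Dop]

theorem Dop_good {w : ℕ} {f : Poly3} (h : Isobaric w f) (h' : NoP f) :
    Dop f = (w : Poly3) * (C (1/12 : ℚ) * X 0) * f + th f := by
  have he := euler h h'
  have e3 : (C (1/3 : ℚ) : Poly3) = 4 * C (1/12) := by
    rw [show (4 : Poly3) = C 4 from rfl, ← C_mul]; norm_num
  have e2 : (C (1/2 : ℚ) : Poly3) = 6 * C (1/12) := by
    rw [show (6 : Poly3) = C 6 from rfl, ← C_mul]; norm_num
  rw [Dop, th, noP_pderiv h', e3, e2]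
  linear_combination (C (1/12 : ℚ) * X 0) * he

theorem Dop_u : Dop (C (1/12 : ℚ) * X 0) = (C (1/12 : ℚ) * X 0) ^ 2 - C (1/144 : ℚ) * X 1 := by
  have e : (C (1/144 : ℚ) : Poly3) = C (1/12) * C (1/12) := by
    rw [← C_mul]; norm_num
  have h1 : pderiv 1 (X 0 : Poly3) = 0 := pderiv_X_of_ne (by decide)
  have h2 : pderiv 2 (X 0 : Poly3) = 0 := pderiv_X_of_ne (by decide)
  rw [Dop, e]
  simp only [pderiv_C_mul, pderiv_X_self, h1, h2]
  ring

theorem stmt_12 (p : ℕ) (hp : p.Prime) (hp5 : 5 ≤ p)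
    (k : ℕ) (hk : 0 < k) (F : Poly3) (hFiso : Isobaric k F) (hFnoP : NoP F)
    (hFint : polyPInt p F) :
    ∃ G H : Poly3, Isobaric (k + 2 * p ^ 2) G ∧ NoP G ∧ polyPInt p G ∧
      polyPInt p H ∧ Dop^[p ^ 2] F - G = (p : Poly3) ^ 2 * H := by
  have hg := fun j => (good_ff hp hp5 ⟨hFiso, hFnoP, hFint⟩ j).1
  have hform := iter_formula DD k (C (1/12 : ℚ) * X 0) (C (1/144 : ℚ) * X 1) (ff k F)
    (by rw [DD_eq, Dop_u]) (by rw [DD_eq]; exact Dop_good hFiso hFnoP)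
    (by
      intro j
      rw [DD_eq, Dop_good (hg (j + 1)).1 (hg (j + 1)).2.1]
      simp only [ff, C_mul]
      rw [show (C (((j + 1) * (k + j) : ℕ) : ℚ) : Poly3) = (((j + 1) * (k + j) : ℕ) : Poly3) from
        map_natCast C _]
      ring) (p ^ 2)
  rw [DD_eq] at hform
  have h12 : pInt p (1/12) := by
    have := pInt_inv hp hp5 2 1
    norm_num at this ⊢
    exact this
  refine ⟨ff k F (p ^ 2), ∑ j ∈ Finset.range (p ^ 2),
    ((cc k (p ^ 2) j / p ^ 2 : ℕ) : Poly3) * (C (1/12 : ℚ) * X 0) ^ (p ^ 2 - j) * ff k F j,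
    (hg _).1, (hg _).2.1, (hg _).2.2, ?_, ?_⟩
  · change _ ∈ intRing p hp
    refine (intRing p hp).sum_mem fun j _ => ?_
    exact (intRing p hp).mul_mem ((intRing p hp).mul_mem (natCast_mem _ _)
      ((intRing p hp).pow_mem ((intRing p hp).mul_mem (C_mem hp h12) (X_mem hp 0)) _)) (hg j).2.2
  · change Dop^[p ^ 2] (ff k F 0) - _ = _
    rw [hform, Finset.sum_range_succ, Finset.mul_sum]
    have : cc k (p ^ 2) (p ^ 2) = 1 := by simp [cc]
    rw [this]
    simp only [Nat.cast_one, Nat.sub_self, pow_zero, one_mul, add_sub_cancel_right]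
    refine Finset.sum_congr rfl fun j hj => ?_
    have hd := Nat.mul_div_cancel' (cc_dvd k (p ^ 2) j (Finset.mem_range.1 hj))
    have hd' : ((p : Poly3) ^ 2) * ((cc k (p ^ 2) j / p ^ 2 : ℕ) : Poly3) = (cc k (p ^ 2) j : Poly3) := by
      exact_mod_cast congrArg (Nat.cast : ℕ → Poly3) hd
    rw [← hd']; ring
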